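/- Let λ, μ ∈ ℝ with μ > 0 and λ + μ > 0, set α := (λ+μ)/(λ+3μ), let 0 < R < q, let k ≥ 3 be an integer, and set c₃ := −(λ+3μ), c₄ := (λ+μ)(q²−R²), and c₅ := −4μ(λ+2μ)/(q³(λ+3μ)). With V^{(i)}(x) := (c₃/k) ( r^k cos(kθ) − kα(r²−q²) r^{k−2} cos((k−2)θ), r^k sin(kθ) + kα(r²−q²) r^{k−2} sin((k−2)θ) ) + c₄ ( r^{k−2} cos((k−2)θ), −r^{k−2} sin((k−2)θ) ) and V^{(o)}(x) := c₄ q^{2(k−2)} ( r^{−(k−2)} cos((k−2)θ) + (k−2)α(r²−q²) r^{−k} cos(kθ), −r^{−(k−2)} sin((k−2)θ) + (k−2)α(r²−q²) r^{−k} sin(kθ) ) + (c₃/k) q^{2k} ( r^{−k} cos(kθ), r^{−k} sin(kθ) ), the following hold for every point x = (q cos θ, q sin θ) on the circle ‖x‖ = q, with ν := x/q: (i) V^{(i)}(x) = V^{(o)}(x), and (ii) ∂V^{(o)}/∂ν(x) − ∂V^{(i)}/∂ν(x) = −c₅ q^k q²(λ+3μ) (cos(kθ), sin(kθ)) + c₅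 q^k (k−2)(λ+μ)(q²−R²) (cos((k−2)θ), −sin((k−2)θ)), where ∂u/∂ν := λ(∇·u)ν + μ(∇u + (∇u)ᵀ)ν is computed from the globally smooth formulas for V^{(i)} and V^{(o)}. -/

import Mathlib

open Real MeasureTheory

noncomputable section

/-- Partial derivative in the first coordinate direction. -/
def pdx (f : ℝ × ℝ → ℝ) (x : ℝ × ℝ) : ℝ := fderiv ℝ f x (1, 0)

/-- Partial derivative in the second coordinate direction. -/
def pdy (f : ℝ × ℝ → ℝ) (x : ℝ × ℝ) : ℝ := fderiv ℝ f x (0, 1)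

/-- Divergence of a planar vector field. -/
def div2 (u : ℝ × ℝ → ℝ × ℝ) (x : ℝ × ℝ) : ℝ :=
  pdx (fun y => (u y).1) x + pdy (fun y => (u y).2) x

/-- Componentwise Laplacian. -/
def lap2 (f : ℝ × ℝ → ℝ) (x : ℝ × ℝ) : ℝ :=
  pdx (fun y => pdx f y) x + pdy (fun y => pdy f y) x

/-- The Lamé operator  μ Δu + (λ+μ) ∇(∇·u). -/
def lame2 (lam mu : ℝ) (u : ℝ × ℝ → ℝ × ℝ) (x : ℝ × ℝ) : ℝ × ℝ :=
  (mu * lap2 (fun y => (u y).1) x + (lam + mu) * pdx (fun y => div2 u y) x,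
   mu * lap2 (fun y => (u y).2) x + (lam + mu) * pdy (fun y => div2 u y) x)

/-- Conormal derivative  λ(∇·u)ν + μ(∇u + (∇u)ᵀ)ν. -/
def trac (lam mu : ℝ) (u : ℝ × ℝ → ℝ × ℝ) (x ν : ℝ × ℝ) : ℝ × ℝ :=
  (lam * div2 u x * ν.1
      + mu * (2 * pdx (fun y => (u y).1) x * ν.1
        + (pdy (fun y => (u y).1) x + pdx (fun y => (u y).2) x) * ν.2),
   lam * div2 u x * ν.2
      + mu * ((pdy (fun y => (u y).1) x + pdx (fun y => (u y).2) x) * ν.1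
        + 2 * pdy (fun y => (u y).2) x * ν.2))

/-- Entries of the symmetric gradient ∇ˢu = (∇u + (∇u)ᵀ)/2. -/
def sg11 (u : ℝ × ℝ → ℝ × ℝ) (x : ℝ × ℝ) : ℝ := pdx (fun y => (u y).1) x

def sg12 (u : ℝ × ℝ → ℝ × ℝ) (x : ℝ × ℝ) : ℝ :=
  (pdy (fun y => (u y).1) x + pdx (fun y => (u y).2) x) / 2

def sg22 (u : ℝ × ℝ → ℝ × ℝ) (x : ℝ × ℝ) : ℝ := pdy (fun y => (u y).2) x

/-- Frobenius inner product ∇ˢu : ∇ˢv of the symmetric gradients of two fields. -/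
def sgFrob (u v : ℝ × ℝ → ℝ × ℝ) (x : ℝ × ℝ) : ℝ :=
  sg11 u x * sg11 v x + 2 * (sg12 u x * sg12 v x) + sg22 u x * sg22 v x

/-- Euclidean norm on ℝ². -/
def nr (x : ℝ × ℝ) : ℝ := Real.sqrt (x.1 ^ 2 + x.2 ^ 2)

/-- The identification of the plane with the complex numbers, `(x, y) ↦ x + i y`. -/
def planeToComplex : ℝ × ℝ →L[ℝ] ℂ := Complex.equivRealProdCLM.symm

/-- The conjugate identification, `(x, y) ↦ x - i y`. -/
def planeToComplexConj : ℝ × ℝ →L[ℝ] ℂ := (Complex.conjCLE : ℂ →L[ℝ] ℂ).comp planeToComplex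

theorem planeToComplex_apply (p : ℝ × ℝ) :
    planeToComplex p = (p.1 : ℂ) + (p.2 : ℂ) * Complex.I :=
  Complex.equivRealProdCLM_symm_apply p

theorem planeToComplex_injective : Function.Injective planeToComplex :=
  Complex.equivRealProdCLM.symm.injective

theorem planeToComplexConj_apply (p : ℝ × ℝ) :
    planeToComplexConj p = (p.1 : ℂ) - (p.2 : ℂ) * Complex.I := by
  simp [planeToComplexConj, planeToComplex_apply, sub_eq_add_neg]

theorem planeToComplex_polar (r θ : ℝ) :
    planeToComplex (r * Real.cos θ, r * Real.sin θ) = r * Complex.exp (θ * Complex.I) := by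
  rw [planeToComplex_apply, Complex.exp_mul_I]
  push_cast
  ring

theorem planeToComplexConj_polar (r θ : ℝ) :
    planeToComplexConj (r * Real.cos θ, r * Real.sin θ) = r * (Complex.exp (θ * Complex.I))⁻¹ := by
  rw [planeToComplexConj_apply, ← Complex.exp_neg, ← neg_mul, Complex.exp_mul_I, Complex.cos_neg,
    Complex.sin_neg]
  push_cast
  ring

theorem planeToComplex_mul_planeToComplexConj_polar (r θ : ℝ) :
    planeToComplex (r * Real.cos θ, r * Real.sin θ)
      * planeToComplexConj (r * Real.cos θ, r * Real.sin θ) = (r : ℂ) ^ 2 := by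
  have hE := Complex.exp_ne_zero (θ * Complex.I)
  rw [planeToComplex_polar, planeToComplexConj_polar]
  field_simp

theorem exists_polar (p : ℝ × ℝ) :
    ∃ r θ : ℝ, 0 ≤ r ∧ p = (r * Real.cos θ, r * Real.sin θ) := by
  refine ⟨‖planeToComplex p‖, (planeToComplex p).arg, norm_nonneg _, planeToComplex_injective ?_⟩
  rw [planeToComplex_polar, Complex.norm_mul_exp_arg_mul_I]

/-- `f` is real differentiable at `p` with Wirtinger derivatives `A` in `z` and `B` in `conj z`. -/
def HasWirtingerAt (f : ℝ × ℝ → ℂ) (A B : ℂ) (p : ℝ × ℝ) : Prop :=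
  HasFDerivAt f (A • planeToComplex + B • planeToComplexConj) p

namespace HasWirtingerAt

variable {f g : ℝ × ℝ → ℂ} {A B C D : ℂ} {p : ℝ × ℝ}

theorem comp_holomorphic {φ : ℂ → ℂ} (h : HasDerivAt φ A (planeToComplex p)) :
    HasWirtingerAt (fun y => φ (planeToComplex y)) A 0 p := by
  have := h.comp_hasFDerivAt_of_eq p planeToComplex.hasFDerivAt rfl
  refine HasFDerivAt.congr_fderiv this ?_
  module

theorem comp_antiholomorphic {φ : ℂ → ℂ} (h : HasDerivAt φ B (planeToComplexConj p)) :
    HasWirtingerAt (fun y => φ (planeToComplexConj y)) 0 B p := by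
  have := h.comp_hasFDerivAt_of_eq p planeToComplexConj.hasFDerivAt rfl
  refine HasFDerivAt.congr_fderiv this ?_
  module

theorem congr_of_eventuallyEq (hf : HasWirtingerAt f A B p) (h : g =ᶠ[nhds p] f) :
    HasWirtingerAt g A B p :=
  HasFDerivAt.congr_of_eventuallyEq hf h

theorem add (hf : HasWirtingerAt f A B p) (hg : HasWirtingerAt g C D p) :
    HasWirtingerAt (fun y => f y + g y) (A + C) (B + D) p := by
  refine (HasFDerivAt.fun_add hf hg).congr_fderiv ?_
  module

theorem mul (hf : HasWirtingerAt f A B p) (hg : HasWirtingerAt g C D p) :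
    HasWirtingerAt (fun y => f y * g y) (f p * C + g p * A) (f p * D + g p * B) p := by
  refine (HasFDerivAt.fun_mul hf hg).congr_fderiv ?_
  module

theorem sub_const (hf : HasWirtingerAt f A B p) (c : ℂ) :
    HasWirtingerAt (fun y => f y - c) A B p :=
  HasFDerivAt.sub_const c hf

theorem const_mul (hf : HasWirtingerAt f A B p) (c : ℂ) :
    HasWirtingerAt (fun y => c * f y) (c * A) (c * B) p := by
  refine (HasFDerivAt.const_mul hf c).congr_fderiv ?_
  module

theorem planeToComplex_pow (n : ℕ) (p : ℝ × ℝ) :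
    HasWirtingerAt (fun y => planeToComplex y ^ n) (n * planeToComplex p ^ (n - 1)) 0 p :=
  comp_holomorphic (φ := fun z => z ^ n) (hasDerivAt_pow n _)

theorem planeToComplexConj_pow (n : ℕ) (p : ℝ × ℝ) :
    HasWirtingerAt (fun y => planeToComplexConj y ^ n) 0 (n * planeToComplexConj p ^ (n - 1)) p :=
  comp_antiholomorphic (φ := fun z => z ^ n) (hasDerivAt_pow n _)

theorem inv_planeToComplex_pow (n : ℕ) (hp : planeToComplex p ≠ 0) :
    HasWirtingerAt (fun y => (planeToComplex y ^ n)⁻¹)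
      (-(n * planeToComplex p ^ (n - 1)) / (planeToComplex p ^ n) ^ 2) 0 p :=
  comp_holomorphic (φ := fun z => (z ^ n)⁻¹) ((hasDerivAt_pow n _).fun_inv (pow_ne_zero n hp))

theorem inv_planeToComplexConj_pow (n : ℕ) (hp : planeToComplexConj p ≠ 0) :
    HasWirtingerAt (fun y => (planeToComplexConj y ^ n)⁻¹) 0
      (-(n * planeToComplexConj p ^ (n - 1)) / (planeToComplexConj p ^ n) ^ 2) p :=
  comp_antiholomorphic (φ := fun z => (z ^ n)⁻¹) ((hasDerivAt_pow n _).fun_inv (pow_ne_zero n hp))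

theorem normSq_sub_const (p : ℝ × ℝ) (c : ℂ) :
    HasWirtingerAt (fun y => planeToComplex y * planeToComplexConj y - c)
      (planeToComplexConj p) (planeToComplex p) p := by
  have h := ((comp_holomorphic (p := p) (hasDerivAt_id _)).mul
    (comp_antiholomorphic (p := p) (hasDerivAt_id _))).sub_const c
  simpa using h

/-- The conormal derivative in terms of the Wirtinger derivatives of the complexified field. -/
theorem trac_eq {u : ℝ × ℝ → ℝ × ℝ}
    (h : HasWirtingerAt (fun y => planeToComplex (u y)) A B p) (lam mu : ℝ) (ν : ℝ × ℝ) :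
    planeToComplex (trac lam mu u p ν)
      = (lam + mu) * (A + (starRingEnd ℂ) A) * planeToComplex ν
        + 2 * mu * B * planeToComplexConj ν := by
  have h1 : HasFDerivAt (fun y => (u y).1)
      (Complex.reCLM.comp (A • planeToComplex + B • planeToComplexConj)) p := by
    simpa [Function.comp_def, planeToComplex_apply] using Complex.reCLM.hasFDerivAt.comp p h
  have h2 : HasFDerivAt (fun y => (u y).2)
      (Complex.imCLM.comp (A • planeToComplex + B • planeToComplexConj)) p := by
    simpa [Function.comp_def, planeToComplex_apply] using Complex.imCLM.hasFDerivAt.comp p h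
  apply Complex.ext <;>
  · simp [trac, div2, pdx, pdy, h1.fderiv, h2.fderiv, planeToComplex_apply,
      planeToComplexConj_apply]
    ring

end HasWirtingerAt

theorem exp_mul_I_pow (n : ℕ) (θ : ℝ) :
    Complex.exp (θ * Complex.I) ^ n
      = (Real.cos (n * θ) : ℂ) + (Real.sin (n * θ) : ℂ) * Complex.I := by
  rw [← Complex.exp_nat_mul, ← mul_assoc, Complex.exp_mul_I]
  push_cast
  ring

theorem inv_exp_mul_I_pow (n : ℕ) (θ : ℝ) :
    (Complex.exp (θ * Complex.I))⁻¹ ^ n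
      = (Real.cos (n * θ) : ℂ) - (Real.sin (n * θ) : ℂ) * Complex.I := by
  rw [← Complex.exp_neg, ← Complex.exp_nat_mul, ← neg_mul, ← mul_assoc, mul_neg, Complex.exp_mul_I,
    Complex.cos_neg, Complex.sin_neg]
  push_cast
  ring

/-- on the circle ‖x‖ = q the interior and exterior parts V^{(i)}, V^{(o)} of the
high-frequency test field V̂_k agree, and the jump of their conormal derivatives reproduces the
Fourier modes (cos kθ, sin kθ) and (cos (k−2)θ, −sin (k−2)θ) with the prescribed coefficients. -/
theorem high_frequency_test_field_jump (lam mu : ℝ) (hmu : 0 < mu)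
    (hlm : 0 < lam + mu) (α : ℝ) (hα : α = (lam + mu) / (lam + 3 * mu))
    (R q : ℝ) (hR : 0 < R) (hq : R < q) (k : ℕ) (hk : 3 ≤ k)
    (c₃ c₄ c₅ : ℝ) (hc₃ : c₃ = -(lam + 3 * mu)) (hc₄ : c₄ = (lam + mu) * (q ^ 2 - R ^ 2))
    (hc₅ : c₅ = -(4 * mu * (lam + 2 * mu)) / (q ^ 3 * (lam + 3 * mu)))
    (Vi Vo : ℝ × ℝ → ℝ × ℝ)
    (hVi : ∀ r θ : ℝ, 0 ≤ r →
      Vi (r * Real.cos θ, r * Real.sin θ)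
        = ((c₃ / (k : ℝ)) * (r ^ k * Real.cos ((k : ℝ) * θ)
              - (k : ℝ) * α * (r ^ 2 - q ^ 2) * r ^ (k - 2) * Real.cos (((k : ℝ) - 2) * θ))
            + c₄ * (r ^ (k - 2) * Real.cos (((k : ℝ) - 2) * θ)),
           (c₃ / (k : ℝ)) * (r ^ k * Real.sin ((k : ℝ) * θ)
              + (k : ℝ) * α * (r ^ 2 - q ^ 2) * r ^ (k - 2) * Real.sin (((k : ℝ) - 2) * θ))
            + c₄ * (-(r ^ (k - 2) * Real.sin (((k : ℝ) - 2) * θ)))))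
    (hVo : ∀ r θ : ℝ, 0 < r →
      Vo (r * Real.cos θ, r * Real.sin θ)
        = (c₄ * q ^ (2 * (k - 2)) * (Real.cos (((k : ℝ) - 2) * θ) / r ^ (k - 2)
              + ((k : ℝ) - 2) * α * (r ^ 2 - q ^ 2) * Real.cos ((k : ℝ) * θ) / r ^ k)
            + (c₃ / (k : ℝ)) * q ^ (2 * k) * (Real.cos ((k : ℝ) * θ) / r ^ k),
           c₄ * q ^ (2 * (k - 2)) * (-(Real.sin (((k : ℝ) - 2) * θ) / r ^ (k - 2))
              + ((k : ℝ) - 2) * α * (r ^ 2 - q ^ 2) * Real.sin ((k : ℝ) * θ) / r ^ k)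
            + (c₃ / (k : ℝ)) * q ^ (2 * k) * (Real.sin ((k : ℝ) * θ) / r ^ k))) :
    ∀ θ : ℝ,
      Vi (q * Real.cos θ, q * Real.sin θ) = Vo (q * Real.cos θ, q * Real.sin θ)
      ∧ trac lam mu Vo (q * Real.cos θ, q * Real.sin θ) (Real.cos θ, Real.sin θ)
          - trac lam mu Vi (q * Real.cos θ, q * Real.sin θ) (Real.cos θ, Real.sin θ)
        = (-(c₅ * q ^ k * (q ^ 2 * (lam + 3 * mu))))
              • (Real.cos ((k : ℝ) * θ), Real.sin ((k : ℝ) * θ))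
          + (c₅ * q ^ k * (((k : ℝ) - 2) * (lam + mu) * (q ^ 2 - R ^ 2)))
              • (Real.cos (((k : ℝ) - 2) * θ), -Real.sin (((k : ℝ) - 2) * θ)) := by
  obtain ⟨n, rfl⟩ : ∃ n, k = n + 3 := ⟨k - 3, by omega⟩
  have hq0 : 0 < q := hR.trans hq
  have hqC : (q : ℂ) ≠ 0 := by exact_mod_cast hq0.ne'
  have hl3 : lam + 3 * mu ≠ 0 := by linarith
  have hn : ((n : ℂ) + 3) ≠ 0 := by exact_mod_cast (Nat.succ_ne_zero (n + 2))
  have hk2 : n + 3 - 2 = n + 1 := by omega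
  have hk2R : (((n + 3 : ℕ) : ℝ) - 2) = ((n + 1 : ℕ) : ℝ) := by push_cast; ring
  simp only [hk2, hk2R] at hVi hVo ⊢
  have hGi : (fun y => planeToComplex (Vi y)) = fun y =>
      (c₃ / ((n + 3 : ℕ) : ℂ)) * planeToComplex y ^ (n + 3)
        + (-(c₃ * α)) * ((planeToComplex y * planeToComplexConj y - (q : ℂ) ^ 2)
            * planeToComplexConj y ^ (n + 1))
        + c₄ * planeToComplexConj y ^ (n + 1) := by
    funext y
    obtain ⟨r, θ, hr, rfl⟩ := exists_polar y
    rw [hVi r θ hr, planeToComplex_mul_planeToComplexConj_polar, planeToComplex_polar,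
      planeToComplexConj_polar]
    simp only [mul_pow, exp_mul_I_pow, inv_exp_mul_I_pow, planeToComplex_apply]
    generalize Real.cos ((n + 3 : ℕ) * θ) = a
    generalize Real.sin ((n + 3 : ℕ) * θ) = b
    generalize Real.cos ((n + 1 : ℕ) * θ) = c
    generalize Real.sin ((n + 1 : ℕ) * θ) = d
    push_cast
    field_simp
    ring
  have hGo : ∀ y, planeToComplex y ≠ 0 → planeToComplex (Vo y) =
      (c₄ * q ^ (2 * (n + 1))) * (planeToComplex y ^ (n + 1))⁻¹
        + (c₄ * q ^ (2 * (n + 1)) * (n + 1) * α)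
          * ((planeToComplex y * planeToComplexConj y - (q : ℂ) ^ 2)
            * (planeToComplexConj y ^ (n + 3))⁻¹)
        + (c₃ / ((n + 3 : ℕ) : ℂ) * q ^ (2 * (n + 3))) * (planeToComplexConj y ^ (n + 3))⁻¹ := by
    intro y hy
    obtain ⟨r, θ, hr, rfl⟩ := exists_polar y
    have hr0 : r ≠ 0 := by
      rintro rfl
      exact hy (by rw [planeToComplex_polar]; simp)
    have hrC : (r : ℂ) ≠ 0 := by exact_mod_cast hr0
    rw [hVo r θ (hr.lt_of_ne' hr0), planeToComplex_mul_planeToComplexConj_polar,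
      planeToComplex_polar, planeToComplexConj_polar]
    have hinv : (Complex.exp (θ * Complex.I) ^ (n + 1))⁻¹
        = (Real.cos ((n + 1 : ℕ) * θ) : ℂ) - (Real.sin ((n + 1 : ℕ) * θ) : ℂ) * Complex.I := by
      rw [← inv_pow, inv_exp_mul_I_pow]
    simp only [mul_pow, mul_inv, inv_pow, inv_inv]
    rw [hinv, exp_mul_I_pow, planeToComplex_apply]
    generalize Real.cos ((n + 3 : ℕ) * θ) = a
    generalize Real.sin ((n + 3 : ℕ) * θ) = b
    generalize Real.cos ((n + 1 : ℕ) * θ) = c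
    generalize Real.sin ((n + 1 : ℕ) * θ) = d
    push_cast
    field_simp
    ring
  intro θ
  set p : ℝ × ℝ := (q * Real.cos θ, q * Real.sin θ)
  have hz : planeToComplex p = q * Complex.exp (θ * Complex.I) := planeToComplex_polar q θ
  have hzc : planeToComplexConj p = q * (Complex.exp (θ * Complex.I))⁻¹ :=
    planeToComplexConj_polar q θ
  have hE : Complex.exp (θ * Complex.I) ≠ 0 := Complex.exp_ne_zero _
  have hz0 : planeToComplex p ≠ 0 := hz ▸ mul_ne_zero hqC hE
  have hzc0 : planeToComplexConj p ≠ 0 := hzc ▸ mul_ne_zero hqC (inv_ne_zero hE)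
  have hν : planeToComplex (Real.cos θ, Real.sin θ) = Complex.exp (θ * Complex.I) := by
    simpa using planeToComplex_polar 1 θ
  have hνc : planeToComplexConj (Real.cos θ, Real.sin θ) = (Complex.exp (θ * Complex.I))⁻¹ := by
    simpa using planeToComplexConj_polar 1 θ
  have hconj : (starRingEnd ℂ) (Complex.exp (θ * Complex.I))
      = (Complex.exp (θ * Complex.I))⁻¹ := by
    rw [← Complex.exp_conj, ← Complex.exp_neg]
    simp
  refine ⟨planeToComplex_injective ?_, planeToComplex_injective ?_⟩
  · rw [hGo p hz0, congrFun hGi p, hz, hzc]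
    generalize Complex.exp (θ * Complex.I) = w at hE
    simp only [mul_pow, inv_pow]
    push_cast
    field_simp
    ring
  · have hWi := ((HasWirtingerAt.planeToComplex_pow (n + 3) p).const_mul
        (c₃ / ((n + 3 : ℕ) : ℂ))).add
      (((HasWirtingerAt.normSq_sub_const p ((q : ℂ) ^ 2)).mul
        (HasWirtingerAt.planeToComplexConj_pow (n + 1) p)).const_mul (-(c₃ * α))) |>.add
      ((HasWirtingerAt.planeToComplexConj_pow (n + 1) p).const_mul c₄)
    rw [← hGi] at hWi
    have hWo := ((HasWirtingerAt.inv_planeToComplex_pow (n + 1) hz0).const_mul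
        (c₄ * q ^ (2 * (n + 1)))).add
      (((HasWirtingerAt.normSq_sub_const p ((q : ℂ) ^ 2)).mul
        (HasWirtingerAt.inv_planeToComplexConj_pow (n + 3) hzc0)).const_mul
          (c₄ * q ^ (2 * (n + 1)) * (n + 1) * α)) |>.add
      ((HasWirtingerAt.inv_planeToComplexConj_pow (n + 3) hzc0).const_mul
        (c₃ / ((n + 3 : ℕ) : ℂ) * q ^ (2 * (n + 3))))
    have hWo' := hWo.congr_of_eventuallyEq
      ((planeToComplex.continuous.continuousAt.eventually_ne hz0).mono hGo)
    rw [map_sub, map_add planeToComplex, map_smul planeToComplex, map_smul planeToComplex,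
      hWo'.trac_eq, hWi.trac_eq, hν, hνc, hz, hzc]
    have hk_mode : planeToComplex (Real.cos ((n + 3 : ℕ) * θ), Real.sin ((n + 3 : ℕ) * θ))
        = Complex.exp (θ * Complex.I) ^ (n + 3) := by
      rw [planeToComplex_apply, exp_mul_I_pow]
    have hm_mode : planeToComplex (Real.cos ((n + 1 : ℕ) * θ), -Real.sin ((n + 1 : ℕ) * θ))
        = (Complex.exp (θ * Complex.I))⁻¹ ^ (n + 1) := by
      rw [planeToComplex_apply, inv_exp_mul_I_pow]
      push_cast
      ring
    have hsum : lam + mu = α * (lam + 3 * mu) := by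
      rw [hα, div_mul_cancel₀ _ hl3]
    have hmuα : mu = (1 - α) * (lam + 3 * mu) / 2 := by linarith
    have hc₅α : c₅ = -((1 - α ^ 2) * (lam + 3 * mu)) / q ^ 3 := by
      have h : 4 * mu * (lam + 2 * mu) = (1 - α ^ 2) * (lam + 3 * mu) * (lam + 3 * mu) := by
        linear_combination 4 * (lam + 2 * mu) * hmuα + (1 - α) * (lam + 3 * mu) * hsum
      rw [hc₅,
        div_eq_div_iff (mul_ne_zero (pow_ne_zero 3 hq0.ne') hl3) (pow_ne_zero 3 hq0.ne')]
      linear_combination -q ^ 3 * h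
    have hcoef : ((n + 1 : ℕ) : ℝ) * (lam + mu) * (q ^ 2 - R ^ 2) = (n + 1 : ℕ) * c₄ := by
      rw [hc₄]
      ring
    have hsumC : (lam : ℂ) + mu = α * ((lam + 3 * mu : ℝ) : ℂ) := by exact_mod_cast hsum
    have hmuC : (mu : ℂ) = (1 - α) * ((lam + 3 * mu : ℝ) : ℂ) / 2 := by exact_mod_cast hmuα
    rw [hk_mode, hm_mode, hcoef, hc₅α, hc₃, hsumC, hmuC]
    generalize lam + 3 * mu = L
    simp only [map_add, map_mul, map_div₀, map_neg, map_pow, map_sub, map_inv₀, map_natCast,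
      Complex.conj_ofReal, hconj, map_one, map_zero, Complex.real_smul]
    generalize Complex.exp (θ * Complex.I) = w at hE
    simp only [Nat.add_sub_cancel, show n + 3 - 1 = n + 2 from rfl, mul_pow, inv_pow, inv_inv]
    push_cast
    field_simp
    ring
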